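/- Let n > 7 be an integer, let P_n ⊂ ℝ³ be the lattice polytope P_n = conv{0, ne₁, ne₂, n(e₁+e₂), e₃, ne₂+e₃, (1−n)e₃} (where e₁, e₂, e₃ is the standard basis of ℝ³), and for 0 < k < n set c_k = (k/n)e₃. Then #((c_k + P_n) ∩ ℤ³) − #(P_n ∩ ℤ³) = k(n+1) − k² − 2n − 1. In particular, for k = 3 this difference equals n − 7 > 0, so the rational translate c₃ + P_n contains strictly more lattice points than the lattice polytope P_n itself. -/

import Mathlib

open Pointwise MeasureTheory
open scoped RealInnerProductSpace

noncomputable section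

/-- Cast an integer vector to a real vector. -/
def castVec {d : ℕ} (x : Fin d → ℤ) : Fin d → ℝ := fun i => (x i : ℝ)

/-- Cast a rational vector to a real vector. -/
def ratVec {d : ℕ} (c : Fin d → ℚ) : Fin d → ℝ := fun i => (c i : ℝ)

/-- `den(c)`: the lcm of the denominators of the coordinates of a rational vector. -/
def denv {d : ℕ} (c : Fin d → ℚ) : ℕ := Finset.univ.lcm fun i => (c i).den

/-- The number of lattice points in a subset of `ℝ^d`. -/
def latCount {d : ℕ} (S : Set (Fin d → ℝ)) : ℕ := {x : Fin d → ℤ | castVec x ∈ S}.ncard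

/-- A lattice polytope: the convex hull of a nonempty finite set of integer points. -/
def IsLatticePolytope {d : ℕ} (P : Set (Fin d → ℝ)) : Prop :=
  ∃ V : Finset (Fin d → ℤ), V.Nonempty ∧ P = convexHull ℝ (castVec '' (V : Set (Fin d → ℤ)))

/-- The zonotope spanned by a finite set of integer vectors. -/
def zonotopeF {d : ℕ} (U : Finset (Fin d → ℤ)) : Set (Fin d → ℝ) :=
  {x | ∃ lam : (Fin d → ℤ) → ℝ, (∀ u, lam u ∈ Set.Icc (0 : ℝ) 1) ∧
    x = ∑ u ∈ U, lam u • castVec u}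

/-- The zonotope spanned by integer vectors `u 0, …, u (n-1)`. -/
def zonotopeZ {d n : ℕ} (u : Fin n → Fin d → ℤ) : Set (Fin d → ℝ) :=
  {x | ∃ lam : Fin n → ℝ, (∀ i, lam i ∈ Set.Icc (0 : ℝ) 1) ∧ x = ∑ i, lam i • castVec (u i)}

/-- The zonotope spanned by real vectors `u 0, …, u (n-1)`. -/
def zonotopeR {d n : ℕ} (u : Fin n → Fin d → ℝ) : Set (Fin d → ℝ) :=
  {x | ∃ lam : Fin n → ℝ, (∀ i, lam i ∈ Set.Icc (0 : ℝ) 1) ∧ x = ∑ i, lam i • u i}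

/-- A zonotope: a translate of the Minkowski sum of finitely many segments `[0, uᵢ]`. -/
def IsZonotope {d : ℕ} (P : Set (Fin d → ℝ)) : Prop :=
  ∃ (n : ℕ) (u : Fin n → Fin d → ℝ) (v : Fin d → ℝ), P = v +ᵥ zonotopeR u

/-- A set is centrally symmetric if it is a translate of its negation. -/
def CentrallySymmetric {d : ℕ} (P : Set (Fin d → ℝ)) : Prop :=
  ∃ v : Fin d → ℝ, P = v +ᵥ (-P)

/-- `f` is a family of constituents of `L` with respect to the period `ρ`. -/
def IsConstituents (L : ℕ → ℚ) (ρ : ℕ) (f : ℕ → Polynomial ℚ) : Prop :=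
  ∀ t : ℕ, 0 < t → L t = (f (t % ρ)).eval (t : ℚ)

/-- `ρ` is a period of the quasi-polynomial `L`. -/
def IsPeriodOf (ρ : ℕ) (L : ℕ → ℚ) : Prop := 0 < ρ ∧ ∃ f, IsConstituents L ρ f

/-- `ρ₀` is the minimal period of the quasi-polynomial `L`. -/
def IsMinimalPeriodOf (ρ₀ : ℕ) (L : ℕ → ℚ) : Prop :=
  IsPeriodOf ρ₀ L ∧ ∀ ρ : ℕ, IsPeriodOf ρ L → ρ₀ ≤ ρ

/-- GCD-property with respect to the period `ρ`: constituents with equal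
`gcd(ρ, ·)` coincide. -/
def GCDProperty (L : ℕ → ℚ) (ρ : ℕ) : Prop :=
  ∀ f : ℕ → Polynomial ℚ, IsConstituents L ρ f →
    ∀ k ℓ : ℕ, Nat.gcd ρ k = Nat.gcd ρ ℓ → f (k % ρ) = f (ℓ % ρ)

/-- Symmetry with respect to the period `ρ`: `f_k = f_{ρ-k}` for `0 ≤ k ≤ ρ`. -/
def SymmetricQP (L : ℕ → ℚ) (ρ : ℕ) : Prop :=
  ∀ f : ℕ → Polynomial ℚ, IsConstituents L ρ f →
    ∀ k : ℕ, k ≤ ρ → f (k % ρ) = f ((ρ - k) % ρ)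

/-- The Ehrhart counting function `t ↦ #(t(c + P) ∩ ℤ^d)` of the translate `c + P`. -/
def ehr {d : ℕ} (P : Set (Fin d → ℝ)) (c : Fin d → ℚ) : ℕ → ℚ :=
  fun t => (latCount ((t : ℝ) • (ratVec c +ᵥ P)) : ℚ)

/-- The dimension of a polytope: the dimension of the direction of its affine hull. -/
def polyDim {d : ℕ} (P : Set (Fin d → ℝ)) : ℕ := Module.finrank ℝ (affineSpan ℝ P).direction

/-- `r` is the relative volume of `P` (of dimension `m`): with respect to any lattice
point `v₀` of `P` and any `ℤ`-basis `b` of the lattice `aff₀(P) ∩ ℤ^d`, `r` is the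
Lebesgue measure of `P` in the coordinates determined by `v₀` and `b`. -/
def IsRelVolOf {d : ℕ} (P : Set (Fin d → ℝ)) (m : ℕ) (r : ℝ) : Prop :=
  ∀ (v₀ : Fin d → ℤ) (b : Fin m → Fin d → ℤ),
    castVec v₀ ∈ P → LinearIndependent ℤ b →
    (∀ x : Fin d → ℤ,
      castVec x ∈ (affineSpan ℝ P).direction ↔ x ∈ Submodule.span ℤ (Set.range b)) →
    r = (volume {lam : Fin m → ℝ | castVec v₀ + ∑ i, lam i • castVec (b i) ∈ P}).toReal

/-- The (real casts of the) elements of `W` are linearly independent over `ℝ`. -/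
def LinIndepF {d : ℕ} (W : Finset (Fin d → ℤ)) : Prop :=
  LinearIndependent ℝ fun w : ↥W => castVec w.1

/-- Almost locally constant: locally constant outside a discrete point set. -/
def AlmostLocallyConstant (f : ℝ → ℝ) : Prop :=
  ∃ D : Set ℝ, DiscreteTopology D ∧ IsLocallyConstant fun x : ↥(Dᶜ) => f ↑x

/-- Almost constant: constant outside a discrete point set. -/
def AlmostConstant (f : ℝ → ℝ) : Prop :=
  ∃ D : Set ℝ, DiscreteTopology D ∧ ∃ r : ℝ, ∀ x ∉ D, f x = r

/-- The face of `P` in the outer normal direction `v`. -/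
def normalFace {d : ℕ} (P : Set (EuclideanSpace ℝ (Fin d)))
    (v : EuclideanSpace ℝ (Fin d)) : Set (EuclideanSpace ℝ (Fin d)) :=
  {x | x ∈ P ∧ ∀ y ∈ P, ⟪y, v⟫ ≤ ⟪x, v⟫}

/-- `F` is a facet of the `d`-polytope `P`: an exposed face of dimension `d - 1`. -/
def IsFacetOf {d : ℕ} (F P : Set (EuclideanSpace ℝ (Fin d))) : Prop :=
  (∃ v : EuclideanSpace ℝ (Fin d), v ≠ 0 ∧ F = normalFace P v) ∧
  Module.finrank ℝ (affineSpan ℝ F).direction = d - 1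
/-- The inequality description of `P_n`. -/
lemma mem_convexHull_P_n_iff {n : ℝ} (hn : 1 < n) (x y z : ℝ) :
    ![x, y, z] ∈ convexHull ℝ
      ({![0, 0, 0], ![n, 0, 0], ![0, n, 0], ![n, n, 0],
        ![0, 0, 1], ![0, n, 1], ![0, 0, 1 - n]} : Set (Fin 3 → ℝ)) ↔
    0 ≤ x ∧ 0 ≤ y ∧ y ≤ n ∧ x ≤ n * (1 - z) ∧
      (n - 1) * x ≤ n * (n - 1 + z) ∧ (n - 1) * y ≤ n * (n - 1 + z) := by
  constructor
  · intro h
    let S : Set (Fin 3 → ℝ) := {p | 0 ≤ p 0 ∧ 0 ≤ p 1 ∧ p 1 ≤ n ∧ p 0 ≤ n * (1 - p 2) ∧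
      (n - 1) * p 0 ≤ n * (n - 1 + p 2) ∧ (n - 1) * p 1 ≤ n * (n - 1 + p 2)}
    have hS : Convex ℝ S := by
      rintro p ⟨p1, p2, p3, p4, p5, p6⟩ q ⟨q1, q2, q3, q4, q5, q6⟩ a b ha hb hab
      obtain rfl : b = 1 - a := by linarith
      simp only [S, Set.mem_ofPred_eq, Pi.add_apply, Pi.smul_apply, smul_eq_mul]
      refine ⟨by positivity, by positivity, ?_, ?_, ?_, ?_⟩
      · linarith [mul_le_mul_of_nonneg_left p3 ha, mul_le_mul_of_nonneg_left q3 hb]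
      · linarith [mul_le_mul_of_nonneg_left p4 ha, mul_le_mul_of_nonneg_left q4 hb]
      · linarith [mul_le_mul_of_nonneg_left p5 ha, mul_le_mul_of_nonneg_left q5 hb]
      · linarith [mul_le_mul_of_nonneg_left p6 ha, mul_le_mul_of_nonneg_left q6 hb]
    have hsub := convexHull_min (t := S) ?_ hS h
    · simpa [S] using hsub
    · intro p hp
      simp only [Set.mem_insert_iff, Set.mem_singleton_iff] at hp
      rcases hp with rfl | rfl | rfl | rfl | rfl | rfl | rfl <;>
        simp [S] <;> (try constructor) <;> (try constructor) <;> nlinarith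
  · rintro ⟨hx, hy, hyn, hxz, hx', hy'⟩
    have key : ∀ w : Fin 7 → ℝ, (∀ i, 0 ≤ w i) → ∑ i, w i = 1 →
        n * (w 1 + w 3) = x → n * (w 2 + w 3 + w 5) = y →
        w 4 + w 5 + w 6 * (1 - n) = z →
        ![x, y, z] ∈ convexHull ℝ
          ({![0, 0, 0], ![n, 0, 0], ![0, n, 0], ![n, n, 0],
            ![0, 0, 1], ![0, n, 1], ![0, 0, 1 - n]} : Set (Fin 3 → ℝ)) := by
      intro w hw hw1 h1 h2 h3
      have := (convex_convexHull ℝ ({![0, 0, 0], ![n, 0, 0], ![0, n, 0], ![n, n, 0],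
            ![0, 0, 1], ![0, n, 1], ![0, 0, 1 - n]} : Set (Fin 3 → ℝ))).sum_mem
        (t := Finset.univ) (w := w)
        (z := ![![0, 0, 0], ![n, 0, 0], ![0, n, 0], ![n, n, 0],
            ![0, 0, 1], ![0, n, 1], ![0, 0, 1 - n]])
        (fun i _ => hw i) hw1 (fun i _ => subset_convexHull ℝ _ (by fin_cases i <;> simp))
      convert this using 1
      ext j
      fin_cases j <;> simp [Fin.sum_univ_succ, ← h1, ← h2, ← h3, Fin.succ] <;> ring
    have hn0 : 0 < n := by linarith
    have hn1 : 0 < n - 1 := by linarith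
    obtain ⟨u, rfl⟩ : ∃ u, x = n * u := ⟨x / n, by field_simp⟩
    obtain ⟨v, rfl⟩ : ∃ v, y = n * v := ⟨y / n, by field_simp⟩
    have hu : 0 ≤ u := by by_contra! h; nlinarith
    have hv : 0 ≤ v := by by_contra! h; nlinarith
    have hv1 : 0 ≤ 1 - v := by by_contra! h; nlinarith
    have huz : 0 ≤ 1 - z - u := by by_contra! h; nlinarith
    rcases le_total 0 z with hz | hz
    · apply key ![(1 - z - u) * (1 - v), u * (1 - v), (1 - z - u) * v, u * v,
        z * (1 - v), z * v, 0]
      · intro i; fin_cases i <;> simp <;> positivity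
      · simp [Fin.sum_univ_succ]; ring
      · simp only [Matrix.cons_val]; ring
      · simp only [Matrix.cons_val]; ring
      · simp only [Matrix.cons_val]; ring
    · obtain ⟨s, rfl⟩ : ∃ s, z = (n - 1) * -s := ⟨-z / (n - 1), by field_simp⟩
      have hs : 0 ≤ s := by by_contra! h; nlinarith
      have hus : 0 ≤ 1 - s - u := by
        by_contra! h; nlinarith [mul_pos (mul_pos hn0 hn1) (neg_pos.2 h)]
      have hvs : 0 ≤ 1 - s - v := by
        by_contra! h; nlinarith [mul_pos (mul_pos hn0 hn1) (neg_pos.2 h)]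
      rcases le_total u v with h | h
      · apply key ![1 - s - v, 0, v - u, u, 0, 0, s]
        · intro i; fin_cases i <;> simp <;> linarith
        · simp [Fin.sum_univ_succ]; ring
        · simp
        · simp
        · simp; ring
      · apply key ![1 - s - u, u - v, 0, v, 0, 0, s]
        · intro i; fin_cases i <;> simp <;> linarith
        · simp [Fin.sum_univ_succ]; ring
        · simp
        · simp
        · simp; ring

/-- Lattice points of a translate of `P_n` along `e₃`, by integer inequalities. -/
lemma castVec_mem_vadd_P_n_iff {n : ℕ} (hn : 1 < n) (k : ℕ) (v : Fin 3 → ℤ) :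
    castVec v ∈ (![0, 0, (k : ℝ) / (n : ℝ)] : Fin 3 → ℝ) +ᵥ convexHull ℝ
      ({![0, 0, 0], ![(n : ℝ), 0, 0], ![0, (n : ℝ), 0], ![(n : ℝ), (n : ℝ), 0],
        ![0, 0, 1], ![0, (n : ℝ), 1], ![0, 0, 1 - (n : ℝ)]} : Set (Fin 3 → ℝ)) ↔
    0 ≤ v 0 ∧ 0 ≤ v 1 ∧ v 1 ≤ n ∧ v 0 ≤ n * (1 - v 2) + k ∧
      (n - 1) * v 0 ≤ n * (n - 1 + v 2) - k ∧ (n - 1) * v 1 ≤ n * (n - 1 + v 2) - k := by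
  have hn' : (1 : ℝ) < n := by exact_mod_cast hn
  have hv : -(![0, 0, (k : ℝ) / (n : ℝ)] : Fin 3 → ℝ) +ᵥ castVec v =
      ![(v 0 : ℝ), (v 1 : ℝ), (v 2 : ℝ) - k / n] := by
    ext j; fin_cases j <;> simp [castVec]; ring
  rw [Set.mem_vadd_set_iff_neg_vadd_mem, hv, mem_convexHull_P_n_iff hn']
  have e1 : (n : ℝ) * (1 - ((v 2 : ℝ) - k / n)) = n * (1 - v 2) + k := by field_simp; ring
  have e2 : (n : ℝ) * (n - 1 + ((v 2 : ℝ) - k / n)) = n * (n - 1 + v 2) - k := by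
    field_simp; ring
  rw [e1, e2]
  norm_cast

/-- Counting integer points of a finite stack of rectangles of sizes `A i × B i`. -/
lemma ncard_stacked_rectangles (N : ℕ) (m : ℤ) (A B : ℕ → ℕ) :
    {v : Fin 3 → ℤ | ∃ i < N, v 2 = i - m ∧ (0 ≤ v 0 ∧ v 0 < A i) ∧ (0 ≤ v 1 ∧ v 1 < B i)}.ncard
      = ∑ i ∈ Finset.range N, A i * B i := by
  let T := (Finset.range N).sigma fun i => Finset.range (A i) ×ˢ Finset.range (B i)
  let f : (Σ _ : ℕ, ℕ × ℕ) → (Fin 3 → ℤ) := fun p => ![p.2.1, p.2.2, p.1 - m]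
  have hf : Function.Injective f := by
    rintro ⟨i, a, b⟩ ⟨i', a', b'⟩ h
    have h0 := congrFun h 0
    have h1 := congrFun h 1
    have h2 := congrFun h 2
    simp [f] at h0 h1 h2
    simp [h0, h1, h2]
  have hT : {v : Fin 3 → ℤ | ∃ i < N, v 2 = i - m ∧ (0 ≤ v 0 ∧ v 0 < A i) ∧
      (0 ≤ v 1 ∧ v 1 < B i)} = ((T.image f : Finset (Fin 3 → ℤ)) : Set (Fin 3 → ℤ)) := by
    ext v
    simp only [Set.mem_ofPred_eq, Finset.coe_image, Set.mem_image, Finset.mem_coe, T,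
      Finset.mem_sigma, Finset.mem_product, Finset.mem_range]
    constructor
    · rintro ⟨i, hi, h2, ⟨h0, h0'⟩, h1, h1'⟩
      refine ⟨⟨i, (v 0).toNat, (v 1).toNat⟩, ⟨hi, ?_, ?_⟩, ?_⟩
      · dsimp only; omega
      · dsimp only; omega
      · ext j; fin_cases j <;> simp [f, h0, h1, h2]
    · rintro ⟨⟨i, a, b⟩, ⟨hi, ha, hb⟩, rfl⟩
      refine ⟨i, hi, ?_⟩
      simp [f] at ha hb ⊢
      omega
  rw [hT, Set.ncard_coe_finset, Finset.card_image_of_injective _ hf]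
  simp [T, Finset.card_sigma]

/-- Skipping the side length `k` in a sum of consecutive squares. -/
lemma sum_range_skip_sq {k N : ℕ} (h : k ≤ N) :
    ∑ i ∈ Finset.range N, (if k ≤ i then i + 1 else i) * (if k ≤ i then i + 1 else i) + k * k
      = ∑ i ∈ Finset.range N, (i + 1) * (i + 1) := by
  induction N, h using Nat.le_induction with
  | base =>
    rw [Finset.sum_congr rfl (g := fun i => i * i)
      fun i hi => by simp [Nat.not_le.2 (Finset.mem_range.1 hi)]]
    rw [← Finset.sum_range_succ (fun i => i * i), Finset.sum_range_succ']
    simp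
  | succ N hN ih =>
    rw [Finset.sum_range_succ, Finset.sum_range_succ, ← ih, if_pos hN]
    ring

lemma mul_le_iff_of_side {m i k : ℤ} (hk : 0 < k) (hkm : k ≤ m) (hi : 0 ≤ i) (him : i ≤ m)
    (x : ℤ) : m * x ≤ (m + 1) * i - k ↔ x < if k ≤ i then i + 1 else i := by
  split_ifs with h
  · constructor
    · intro hx; by_contra! hc; nlinarith
    · intro hx; nlinarith
  · constructor
    · intro hx; by_contra! hc; nlinarith
    · intro hx; nlinarith

lemma latCount_P_n {n : ℕ} (hn : 1 < n) :
    latCount (convexHull ℝ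
      ({![0, 0, 0], ![(n : ℝ), 0, 0], ![0, (n : ℝ), 0], ![(n : ℝ), (n : ℝ), 0],
        ![0, 0, 1], ![0, (n : ℝ), 1], ![0, 0, 1 - (n : ℝ)]} : Set (Fin 3 → ℝ))) =
    ∑ i ∈ Finset.range (n - 1), (i + 1) * (i + 1) + (n + 1) * (n + 1) + (n + 1) := by
  obtain ⟨m, rfl⟩ : ∃ m, n = m + 1 := ⟨n - 1, by omega⟩
  have hm : 0 < m := by omega
  let A : ℕ → ℕ := fun i => if i < m then i + 1 else if i = m then m + 2 else 1
  let B : ℕ → ℕ := fun i => if i < m then i + 1 else m + 2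
  have hs : ∑ i ∈ Finset.range (m + 2), A i * B i =
      ∑ i ∈ Finset.range m, (i + 1) * (i + 1) + (m + 2) * (m + 2) + (m + 2) := by
    rw [Finset.sum_range_succ, Finset.sum_range_succ]
    congr 1
    · congr 1
      · exact Finset.sum_congr rfl fun i hi => by simp [A, B, Finset.mem_range.1 hi]
      · simp [A, B]
    · simp [A, B]
  refine Eq.trans ?_ hs
  rw [← ncard_stacked_rectangles _ (m : ℤ)]
  unfold latCount
  congr 1
  ext v
  have h0 := castVec_mem_vadd_P_n_iff hn 0 v
  have hz : (![0, 0, ((0 : ℕ) : ℝ) / ((m + 1 : ℕ) : ℝ)] : Fin 3 → ℝ) = 0 := by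
    ext j; fin_cases j <;> simp
  rw [hz, zero_vadd] at h0
  simp only [Set.mem_ofPred_eq]
  rw [h0]
  push_cast
  generalize v 0 = x
  generalize v 1 = y
  generalize v 2 = z
  have hm' : (0 : ℤ) < m := by exact_mod_cast hm
  constructor
  · rintro ⟨hx, hy, hyn, h1, h2, h3⟩
    have hz0 : 0 ≤ z + m := by by_contra! h; nlinarith
    have hz1 : z ≤ 1 := by by_contra! h; nlinarith
    refine ⟨(z + m).toNat, by omega, by omega, ⟨hx, ?_⟩, hy, ?_⟩
    · simp only [A]
      split_ifs with ha hb
      · have hz2 : z < 0 := by omega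
        have : x ≤ z + m := by
          by_contra! h
          nlinarith [mul_le_mul_of_nonneg_left (Int.add_one_le_of_lt h) hm'.le]
        omega
      · obtain rfl : z = 0 := by omega
        push_cast; nlinarith
      · obtain rfl : z = 1 := by omega
        push_cast; nlinarith
    · simp only [B]
      split_ifs with ha
      · have hz2 : z < 0 := by omega
        have : y ≤ z + m := by
          by_contra! h
          nlinarith [mul_le_mul_of_nonneg_left (Int.add_one_le_of_lt h) hm'.le]
        omega
      · push_cast; linarith
  · rintro ⟨i, hi, rfl, ⟨hx, hxA⟩, hy, hyB⟩
    simp only [A, B] at hxA hyB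
    rcases lt_trichotomy i m with h | h | h
    · simp only [h, if_true] at hxA hyB
      push_cast at hxA hyB
      have hi' : (i : ℤ) + 1 ≤ m := by exact_mod_cast h
      refine ⟨hx, hy, by linarith, by nlinarith, by nlinarith, by nlinarith⟩
    · subst h
      simp at hxA hyB
      refine ⟨hx, hy, by linarith, by nlinarith, by nlinarith, by nlinarith⟩
    · obtain rfl : i = m + 1 := by omega
      simp at hxA hyB
      push_cast
      refine ⟨hx, hy, by linarith, by nlinarith, by nlinarith, by nlinarith⟩

lemma latCount_vadd_P_n {n k : ℕ} (hk0 : 0 < k) (hkn : k < n) :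
    latCount ((![0, 0, (k : ℝ) / (n : ℝ)] : Fin 3 → ℝ) +ᵥ convexHull ℝ
      ({![0, 0, 0], ![(n : ℝ), 0, 0], ![0, (n : ℝ), 0], ![(n : ℝ), (n : ℝ), 0],
        ![0, 0, 1], ![0, (n : ℝ), 1], ![0, 0, 1 - (n : ℝ)]} : Set (Fin 3 → ℝ))) + k * k =
    ∑ i ∈ Finset.range n, (i + 1) * (i + 1) + (k + 1) * (n + 1) := by
  have hn : 1 < n := by omega
  obtain ⟨m, rfl⟩ : ∃ m, n = m + 1 := ⟨n - 1, by omega⟩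
  let s : ℕ → ℕ := fun i => if k ≤ i then i + 1 else i
  let A : ℕ → ℕ := fun i => if i ≤ m then s i else k + 1
  let B : ℕ → ℕ := fun i => if i ≤ m then s i else m + 2
  have hs : ∑ i ∈ Finset.range (m + 2), A i * B i =
      ∑ i ∈ Finset.range (m + 1), s i * s i + (k + 1) * (m + 2) := by
    rw [Finset.sum_range_succ]
    congr 1
    · exact Finset.sum_congr rfl fun i hi => by
        simp [A, B, Nat.lt_succ_iff.1 (Finset.mem_range.1 hi)]
    · simp [A, B]
  rw [← sum_range_skip_sq hkn.le, add_right_comm]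
  refine congrArg (· + k * k) (Eq.trans ?_ hs)
  rw [← ncard_stacked_rectangles _ (m : ℤ)]
  unfold latCount
  congr 1
  ext v
  simp only [Set.mem_ofPred_eq]
  rw [castVec_mem_vadd_P_n_iff hn]
  push_cast
  generalize v 0 = x
  generalize v 1 = y
  generalize v 2 = z
  have hk0' : (0 : ℤ) < k := by exact_mod_cast hk0
  have hkm : (k : ℤ) ≤ m := by omega
  have hside : ∀ i : ℕ, i ≤ m → ∀ x : ℤ,
      ((m : ℤ) + 1 - 1) * x ≤ (m + 1) * (m + 1 - 1 + (i - m)) - k ↔ x < (s i : ℕ) := by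
    intro i hi x
    have := mul_le_iff_of_side hk0' hkm (Int.natCast_nonneg i) (by exact_mod_cast hi) x
    simp only [s]
    push_cast
    rw [add_sub_cancel_right, add_sub_cancel, this]
    norm_cast
  have hs_le : ∀ i, s i ≤ i + 1 := fun i => by simp only [s]; split_ifs <;> omega
  constructor
  · rintro ⟨hx, hy, hyn, h1, h2, h3⟩
    have hz0 : 0 ≤ z + m := by by_contra! h; nlinarith
    have hz1 : z ≤ 1 := by by_contra! h; nlinarith
    obtain ⟨i, hi⟩ := Int.eq_ofNat_of_zero_le hz0
    obtain rfl : z = i - m := by omega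
    refine ⟨i, by omega, rfl, ⟨hx, ?_⟩, hy, ?_⟩
    · simp only [A]
      split_ifs with ha
      · exact (hside i ha x).1 h2
      · obtain rfl : i = m + 1 := by omega
        push_cast at h1 ⊢; nlinarith
    · simp only [B]
      split_ifs with ha
      · exact (hside i ha y).1 h3
      · push_cast; linarith
  · rintro ⟨i, hi, rfl, ⟨hx, hxA⟩, hy, hyB⟩
    simp only [A, B] at hxA hyB
    by_cases h : i ≤ m
    · simp only [h, if_true] at hxA hyB
      have hi' : (i : ℤ) ≤ m := by exact_mod_cast h
      have hsi : (s i : ℤ) ≤ i + 1 := by exact_mod_cast hs_le i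
      exact ⟨hx, hy, by linarith, by nlinarith, (hside i h x).2 hxA, (hside i h y).2 hyB⟩
    · obtain rfl : i = m + 1 := by omega
      simp at hxA hyB
      push_cast
      refine ⟨hx, hy, by linarith, by nlinarith, by nlinarith, by nlinarith⟩

/-- For `n > 7` and `0 < k < n`, translating
`P_n = conv{0, ne₁, ne₂, n(e₁+e₂), e₃, ne₂+e₃, (1−n)e₃} ⊂ ℝ³` by `c_k = (k/n)e₃` gives
`#((c_k + P_n) ∩ ℤ³) − #(P_n ∩ ℤ³) = k(n+1) − k² − 2n − 1`; in particular for `k = 3`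
the translate contains strictly more lattice points than `P_n`. -/
theorem latCount_translate_P_n (n k : ℕ) (hn : 7 < n) (hk0 : 0 < k) (hkn : k < n)
    (P : Set (Fin 3 → ℝ))
    (hPn : P = convexHull ℝ
      ({![0, 0, 0], ![(n : ℝ), 0, 0], ![0, (n : ℝ), 0], ![(n : ℝ), (n : ℝ), 0],
        ![0, 0, 1], ![0, (n : ℝ), 1], ![0, 0, 1 - (n : ℝ)]} : Set (Fin 3 → ℝ)))
    (c : Fin 3 → ℝ) (hc : c = ![0, 0, (k : ℝ) / (n : ℝ)]) :
    (latCount (c +ᵥ P) : ℤ) - (latCount P : ℤ) =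
      (k : ℤ) * ((n : ℤ) + 1) - (k : ℤ) ^ 2 - 2 * (n : ℤ) - 1 ∧
    (k = 3 → latCount P < latCount (c +ᵥ P)) := by
  subst hPn hc
  have h1 := latCount_P_n (n := n) (by omega)
  have h2 := latCount_vadd_P_n hk0 hkn
  generalize convexHull ℝ (_ : Set (Fin 3 → ℝ)) = S at h1 h2 ⊢
  generalize latCount S = a at h1 ⊢
  generalize latCount ((_ : Fin 3 → ℝ) +ᵥ S) = b at h2 ⊢
  obtain ⟨m, rfl⟩ : ∃ m, n = m + 1 := ⟨n - 1, by omega⟩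
  rw [Finset.sum_range_succ] at h2
  rw [Nat.add_sub_cancel] at h1
  generalize ∑ i ∈ Finset.range m, (i + 1) * (i + 1) = t at h1 h2
  have hd : (b : ℤ) - a =
      (k : ℤ) * (((m + 1 : ℕ) : ℤ) + 1) - (k : ℤ) ^ 2 - 2 * ((m + 1 : ℕ) : ℤ) - 1 := by
    zify at h1 h2
    push_cast
    linear_combination h2 - h1
  refine ⟨hd, ?_⟩
  rintro rfl
  push_cast at hd
  omega
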